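/- For any three octonions x, y, z ∈ 𝕆 there exists an ℝ-algebra automorphism φ of 𝕆 such that φ(x) lies in the real span of {1, i}, φ(y) lies in the real span of {1, i, j}, and φ(z) lies in the real span of {1, i, j, k, ℓ}. (That is, any three octonions can be brought to generic form by a suitable choice of basis.) -/

import Mathlib

noncomputable section

/-- The octonions, as the Cayley–Dickson double of the quaternions. -/
def Octonion : Type := Quaternion ℝ × Quaternion ℝ

namespace Octonion

instance : AddCommGroup Octonion :=
  inferInstanceAs (AddCommGroup (Quaternion ℝ × Quaternion ℝ))

instance : Module ℝ Octonion :=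
  inferInstanceAs (Module ℝ (Quaternion ℝ × Quaternion ℝ))

/-- Cayley–Dickson multiplication: (a,b)·(c,d) = (a c − conj(d) b, d a + b conj(c)). -/
instance : Mul Octonion :=
  ⟨fun x y => (x.1 * y.1 - star y.2 * x.2, y.2 * x.1 + x.2 * star y.1)⟩

instance : One Octonion := ⟨((1 : Quaternion ℝ), 0)⟩

/-- Octonionic conjugation: conj (a,b) = (conj a, −b). -/
def conj (x : Octonion) : Octonion := (star x.1, -x.2)

/-- Real part of an octonion. -/
def re (x : Octonion) : ℝ := x.1.re

/-- Imaginary part of an octonion. -/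
def im (x : Octonion) : Octonion := x - re x • 1

/-- Embedding of the reals into the octonions. -/
def ofReal (r : ℝ) : Octonion := (((r : ℝ) : Quaternion ℝ), 0)

/-- The squared norm |w|² (the real scalar such that w · conj w = |w|² · 1). -/
def normSq (x : Octonion) : ℝ := Quaternion.normSq x.1 + Quaternion.normSq x.2

/-- The imaginary unit i. -/
def i : Octonion := ((⟨0, 1, 0, 0⟩ : Quaternion ℝ), 0)

/-- The imaginary unit j. -/
def j : Octonion := ((⟨0, 0, 1, 0⟩ : Quaternion ℝ), 0)

/-- The imaginary unit k. -/
def k : Octonion := ((⟨0, 0, 0, 1⟩ : Quaternion ℝ), 0)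

/-- The imaginary unit ℓ. -/
def l : Octonion := ((0 : Quaternion ℝ), (1 : Quaternion ℝ))

/-- The associator [x,y,z] = (xy)z − x(yz). -/
def assoc (x y z : Octonion) : Octonion := x * y * z - x * (y * z)

/-- A Jordan matrix: a 3×3 Hermitian matrix over the octonions. -/
def IsHermitian (A : Matrix (Fin 3) (Fin 3) Octonion) : Prop :=
  ∀ p q : Fin 3, conj (A q p) = A p q

/-- The right eigenvalue equation `A v = v λ`, componentwise. -/
def Eig (A : Matrix (Fin 3) (Fin 3) Octonion) (v : Fin 3 → Octonion) (lam : Octonion) : Prop :=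
  ∀ p : Fin 3, A p 0 * v 0 + A p 1 * v 1 + A p 2 * v 2 = v p * lam

end Octonion

open scoped Quaternion

namespace Octonion

/-- The quaternion with the given coordinates. -/
def quat (a b c d : ℝ) : ℍ[ℝ] := ⟨a, b, c, d⟩

@[simp] lemma quat_re (a b c d : ℝ) : (quat a b c d).re = a := rfl
@[simp] lemma quat_imI (a b c d : ℝ) : (quat a b c d).imI = b := rfl
@[simp] lemma quat_imJ (a b c d : ℝ) : (quat a b c d).imJ = c := rfl
@[simp] lemma quat_imK (a b c d : ℝ) : (quat a b c d).imK = d := rfl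

/-- The octonion `a + b ℓ`. -/
def pair (a b : ℍ[ℝ]) : Octonion := (a, b)

@[simp] lemma pair_fst (a b : ℍ[ℝ]) : (pair a b).1 = a := rfl
@[simp] lemma pair_snd (a b : ℍ[ℝ]) : (pair a b).2 = b := rfl

@[ext]
lemma ext' {x y : Octonion} (h₁ : x.1 = y.1) (h₂ : x.2 = y.2) : x = y := Prod.ext h₁ h₂

@[simp] lemma fst_add (x y : Octonion) : (x + y).1 = x.1 + y.1 := rfl
@[simp] lemma snd_add (x y : Octonion) : (x + y).2 = x.2 + y.2 := rfl
@[simp] lemma fst_smul (r : ℝ) (x : Octonion) : (r • x).1 = r • x.1 := rfl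
@[simp] lemma snd_smul (r : ℝ) (x : Octonion) : (r • x).2 = r • x.2 := rfl
@[simp] lemma fst_mul (x y : Octonion) : (x * y).1 = x.1 * y.1 - star y.2 * x.2 := rfl
@[simp] lemma snd_mul (x y : Octonion) : (x * y).2 = y.2 * x.1 + x.2 * star y.1 := rfl
@[simp] lemma fst_one : (1 : Octonion).1 = 1 := rfl
@[simp] lemma snd_one : (1 : Octonion).2 = 0 := rfl
@[simp] lemma i_fst : i.1 = quat 0 1 0 0 := rfl
@[simp] lemma i_snd : i.2 = 0 := rfl
@[simp] lemma j_fst : j.1 = quat 0 0 1 0 := rfl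
@[simp] lemma j_snd : j.2 = 0 := rfl
@[simp] lemma k_fst : k.1 = quat 0 0 0 1 := rfl
@[simp] lemma k_snd : k.2 = 0 := rfl
@[simp] lemma l_fst : l.1 = 0 := rfl
@[simp] lemma l_snd : l.2 = 1 := rfl

/-- A linear automorphism of the octonions that is unital and multiplicative. -/
def IsAut (φ : Octonion ≃ₗ[ℝ] Octonion) : Prop :=
  (∀ a b : Octonion, φ (a * b) = φ a * φ b) ∧ φ 1 = 1

lemma IsAut.trans {φ ψ : Octonion ≃ₗ[ℝ] Octonion} (hφ : IsAut φ) (hψ : IsAut ψ) :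
    IsAut (φ.trans ψ) :=
  ⟨fun a b => by simp [hφ.1, hψ.1], by simp [hφ.2, hψ.2]⟩

/-- The automorphism `(a, b) ↦ (p a p⁻¹, q b p⁻¹)` attached to unit quaternions `p` and `q`. -/
def rot (p q : unitary ℍ[ℝ]) : Octonion ≃ₗ[ℝ] Octonion where
  toFun x := pair ((p : ℍ[ℝ]) * x.1 * star (p : ℍ[ℝ])) ((q : ℍ[ℝ]) * x.2 * star (p : ℍ[ℝ]))
  invFun x := pair (star (p : ℍ[ℝ]) * x.1 * (p : ℍ[ℝ])) (star (q : ℍ[ℝ]) * x.2 * (p : ℍ[ℝ]))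
  map_add' x y := by ext1 <;> simp [mul_add, add_mul]
  map_smul' r x := by ext1 <;> simp
  left_inv x := by
    have hp (a : ℍ[ℝ]) : star (p : ℍ[ℝ]) * (p * a) = a := by
      rw [← mul_assoc, Unitary.coe_star_mul_self, one_mul]
    have hq (a : ℍ[ℝ]) : star (q : ℍ[ℝ]) * (q * a) = a := by
      rw [← mul_assoc, Unitary.coe_star_mul_self, one_mul]
    ext1 <;> simp [mul_assoc, hp, hq]
  right_inv x := by
    have hp (a : ℍ[ℝ]) : (p : ℍ[ℝ]) * (star (p : ℍ[ℝ]) * a) = a := by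
      rw [← mul_assoc, Unitary.mul_star_self_of_mem p.2, one_mul]
    have hq (a : ℍ[ℝ]) : (q : ℍ[ℝ]) * (star (q : ℍ[ℝ]) * a) = a := by
      rw [← mul_assoc, Unitary.mul_star_self_of_mem q.2, one_mul]
    ext1 <;> simp [mul_assoc, hp, hq]

@[simp] lemma rot_fst (p q : unitary ℍ[ℝ]) (x : Octonion) :
    (rot p q x).1 = (p : ℍ[ℝ]) * x.1 * star (p : ℍ[ℝ]) := rfl

@[simp] lemma rot_snd (p q : unitary ℍ[ℝ]) (x : Octonion) :
    (rot p q x).2 = (q : ℍ[ℝ]) * x.2 * star (p : ℍ[ℝ]) := rfl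

lemma isAut_rot (p q : unitary ℍ[ℝ]) : IsAut (rot p q) := by
  have hp (a : ℍ[ℝ]) : star (p : ℍ[ℝ]) * (p * a) = a := by
    rw [← mul_assoc, Unitary.coe_star_mul_self, one_mul]
  have hq (a : ℍ[ℝ]) : star (q : ℍ[ℝ]) * (q * a) = a := by
    rw [← mul_assoc, Unitary.coe_star_mul_self, one_mul]
  refine ⟨fun a b => ?_, ?_⟩
  · ext1 <;> simp [mul_add, add_mul, mul_sub, sub_mul, mul_assoc, hp, hq]
  · ext1 <;> simp

/-- The involutive automorphism that fixes `i` and exchanges `j` and `ℓ`. -/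
def swap : Octonion ≃ₗ[ℝ] Octonion where
  toFun x := pair (quat x.1.re x.1.imI x.2.re x.2.imI)
    (quat x.1.imJ x.1.imK (-x.2.imJ) (-x.2.imK))
  invFun x := pair (quat x.1.re x.1.imI x.2.re x.2.imI)
    (quat x.1.imJ x.1.imK (-x.2.imJ) (-x.2.imK))
  map_add' x y := by ext <;> simp <;> ring
  map_smul' r x := by ext <;> simp
  left_inv x := by ext <;> simp
  right_inv x := by ext <;> simp

@[simp] lemma swap_fst (x : Octonion) :
    (swap x).1 = quat x.1.re x.1.imI x.2.re x.2.imI := rfl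

@[simp] lemma swap_snd (x : Octonion) :
    (swap x).2 = quat x.1.imJ x.1.imK (-x.2.imJ) (-x.2.imK) := rfl

lemma isAut_swap : IsAut swap := by
  refine ⟨fun a b => ?_, ?_⟩
  · ext <;> simp <;> ring
  · ext <;> simp

lemma inv_norm_smul_mem_unitary {c : ℍ[ℝ]} (hc : c ≠ 0) : ‖c‖⁻¹ • c ∈ unitary ℍ[ℝ] := by
  have h : ‖c‖ ≠ 0 := norm_ne_zero_iff.mpr hc
  have hn : Quaternion.normSq (‖c‖⁻¹ • c) = 1 := by
    rw [Quaternion.normSq_smul, Quaternion.normSq_eq_norm_mul_self]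
    field_simp
  rw [Unitary.mem_iff, Quaternion.star_mul_self, Quaternion.self_mul_star, hn]
  simp

lemma exists_unitary_mul_eq_coe (b : ℍ[ℝ]) :
    ∃ q : unitary ℍ[ℝ], ∃ r : ℝ, (q : ℍ[ℝ]) * b = (r : ℍ[ℝ]) := by
  by_cases hb : b = 0
  · exact ⟨1, 0, by simp [hb]⟩
  · refine ⟨⟨‖star b‖⁻¹ • star b, inv_norm_smul_mem_unitary (by simpa using hb)⟩,
      ‖star b‖⁻¹ * Quaternion.normSq b, ?_⟩
    simp [Quaternion.star_mul_self, ← Quaternion.coe_smul]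

lemma exists_unitary_conj_complex (a : ℍ[ℝ]) :
    ∃ p : unitary ℍ[ℝ], ((p : ℍ[ℝ]) * a * star (p : ℍ[ℝ])).imJ = 0 ∧
      ((p : ℍ[ℝ]) * a * star (p : ℍ[ℝ])).imK = 0 := by
  set r := √(a.imI ^ 2 + a.imJ ^ 2 + a.imK ^ 2)
  have hr : r ^ 2 = a.imI ^ 2 + a.imJ ^ 2 + a.imK ^ 2 := Real.sq_sqrt (by positivity)
  set c := quat 0 (a.imI + r) a.imJ a.imK with hc
  by_cases h0 : c = 0
  · have hJ : a.imJ = 0 := congrArg QuaternionAlgebra.imJ h0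
    have hK : a.imK = 0 := congrArg QuaternionAlgebra.imK h0
    exact ⟨1, by simp [hJ, hK]⟩
  · have key : c * a = quat a.re r 0 0 * c := by
      ext <;> simp [hc] <;> first | linear_combination hr | ring
    set p : unitary ℍ[ℝ] := ⟨‖c‖⁻¹ • c, inv_norm_smul_mem_unitary h0⟩ with hp
    have hpa : (p : ℍ[ℝ]) * a * star (p : ℍ[ℝ]) = quat a.re r 0 0 := by
      have : (p : ℍ[ℝ]) * a = quat a.re r 0 0 * p := by
        rw [hp, smul_mul_assoc, key, mul_smul_comm]
      rw [this, mul_assoc, Unitary.mul_star_self_of_mem p.2, mul_one]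
    exact ⟨p, by rw [hpa]; exact ⟨rfl, rfl⟩⟩

lemma exists_aut_mem_complex_add_j (x : Octonion) :
    ∃ φ : Octonion ≃ₗ[ℝ] Octonion, IsAut φ ∧ φ i = i ∧ (φ x).2 = 0 ∧ (φ x).1.imK = 0 := by
  have hj : quat 0 0 1 0 ∈ unitary ℍ[ℝ] := by
    rw [Unitary.mem_iff]
    constructor <;> ext <;> simp
  obtain ⟨q, r, hq⟩ := exists_unitary_mul_eq_coe x.2
  set ψ := (rot 1 (⟨_, hj⟩ * q)).trans swap with hψ
  obtain ⟨q', r', hq'⟩ := exists_unitary_mul_eq_coe (ψ x).2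
  refine ⟨(ψ.trans (rot 1 q')).trans swap,
    (((isAut_rot _ _).trans isAut_swap).trans (isAut_rot _ _)).trans isAut_swap, ?_, ?_, ?_⟩
  · ext <;> simp [hψ]
  · have h : (ψ x).1.imJ = 0 ∧ (ψ x).1.imK = 0 := by
      simp [hψ, mul_assoc, hq]
    ext <;> simp [hq', h.1, h.2]
  · simp [hq']

lemma mem_span_one_i {x : Octonion} (h : x.2 = 0) (hJ : x.1.imJ = 0) (hK : x.1.imK = 0) :
    x ∈ Submodule.span ℝ ({1, i} : Set Octonion) := by
  rw [Submodule.mem_span_pair]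
  refine ⟨x.1.re, x.1.imI, ?_⟩
  ext <;> simp [h, hJ, hK]

lemma mem_span_one_i_j {x : Octonion} (h : x.2 = 0) (hK : x.1.imK = 0) :
    x ∈ Submodule.span ℝ ({1, i, j} : Set Octonion) := by
  rw [Submodule.mem_span_triple]
  refine ⟨x.1.re, x.1.imI, x.1.imJ, ?_⟩
  ext <;> simp [h, hK]

lemma mem_span_one_i_j_k_l {x : Octonion} {r : ℝ} (h : x.2 = (r : ℍ[ℝ])) :
    x ∈ Submodule.span ℝ ({1, i, j, k, l} : Set Octonion) := by
  simp only [Submodule.mem_span_insert, Submodule.mem_span_singleton, exists_exists_eq_and,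
    ↓existsAndEq, true_and]
  refine ⟨x.1.re, x.1.imI, x.1.imJ, x.1.imK, r, ?_⟩
  ext <;> simp [h]

end Octonion

open Octonion in
/-- Any three octonions can be brought to generic form by an ℝ-algebra automorphism of 𝕆:
there is an ℝ-linear, unital, multiplicative automorphism φ with φ(x) ∈ span{1,i},
φ(y) ∈ span{1,i,j}, and φ(z) ∈ span{1,i,j,k,ℓ}. -/
theorem exists_automorphism_generic (x y z : Octonion) :
    ∃ φ : Octonion ≃ₗ[ℝ] Octonion,
      (∀ a b : Octonion, φ (a * b) = φ a * φ b) ∧ φ 1 = 1 ∧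
      φ x ∈ Submodule.span ℝ ({1, i} : Set Octonion) ∧
      φ y ∈ Submodule.span ℝ ({1, i, j} : Set Octonion) ∧
      φ z ∈ Submodule.span ℝ ({1, i, j, k, l} : Set Octonion) := by
  obtain ⟨φ₁, h₁, -, hx₁, -⟩ := exists_aut_mem_complex_add_j x
  obtain ⟨p, hpJ, hpK⟩ := exists_unitary_conj_complex (φ₁ x).1
  have hx₂ : rot p 1 (φ₁ x) ∈ Submodule.span ℝ ({1, i} : Set Octonion) :=
    mem_span_one_i (by simp [hx₁]) hpJ hpK
  obtain ⟨φ₂, h₂, hi₂, hy₂, hyK⟩ := exists_aut_mem_complex_add_j (rot p 1 (φ₁ y))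
  obtain ⟨q, r, hq⟩ := exists_unitary_mul_eq_coe (φ₂ (rot p 1 (φ₁ z))).2
  have h := ((h₁.trans (isAut_rot p 1)).trans h₂).trans (isAut_rot 1 q)
  refine ⟨_, h.1, h.2, ?_, mem_span_one_i_j ?_ ?_, mem_span_one_i_j_k_l (r := r) ?_⟩
  · obtain ⟨s, t, hst⟩ := Submodule.mem_span_pair.mp hx₂
    have hi : rot 1 q i = i := by ext <;> simp
    refine Submodule.mem_span_pair.mpr ⟨s, t, ?_⟩
    simp only [LinearEquiv.trans_apply, ← hst, map_add, map_smul, h₂.2, hi₂, hi,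
      (isAut_rot 1 q).2]
  · simp [hy₂]
  · simp [hyK]
  · simp [hq]
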